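/- arXiv:1403.6986 — 3 statements merged into one kernel-verified Lean document; each statement's English description precedes it below -/
import Mathlib

section
/- Let K ⊆ ℝ² be a nonempty q-compact convex set with (α,v) ≠ (u,β), and suppose K has nonempty interior in the q-topology. Let L₁ := {(α, y) : y ≤ v} and L₂ := {(x, β) : x ≤ u}. Then the convex hull of L₁ ∪ L₂ is contained in K. -/
open Set Pointwise

/-- The topology on `X` induced by the asymmetric "norm" `q`:
`U` is open iff around each of its points it contains a forward ball `{y | q (y - x) < ε}`. -/
def ballTop {X : Type*} [Sub X] (q : X → ℝ) : TopologicalSpace X where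
  IsOpen U := ∀ x ∈ U, ∃ ε > 0, ∀ y, q (y - x) < ε → y ∈ U
  isOpen_univ := fun _ _ => ⟨1, one_pos, fun _ _ => trivial⟩
  isOpen_inter := fun U V hU hV x hx => by
    obtain ⟨ε₁, hε₁, h₁⟩ := hU x hx.1
    obtain ⟨ε₂, hε₂, h₂⟩ := hV x hx.2
    exact ⟨min ε₁ ε₂, lt_min hε₁ hε₂, fun y hy =>
      ⟨h₁ y (hy.trans_le (min_le_left _ _)), h₂ y (hy.trans_le (min_le_right _ _))⟩⟩
  isOpen_sUnion := fun S hS x hx => by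
    obtain ⟨U, hUS, hxU⟩ := hx
    obtain ⟨ε, hε, h⟩ := hS U hUS x hxU
    exact ⟨ε, hε, fun y hy => ⟨U, hUS, h y hy⟩⟩

/-- The asymmetric lattice norm on `ℝ²` induced by a lattice norm `N`: `q x = N (x ∨ 0)`. -/
def q2 (N : ℝ × ℝ → ℝ) : ℝ × ℝ → ℝ := fun x => N (max x.1 0, max x.2 0)

/-- `θ₀ = {x | q x = 0}`. -/
def theta0 (N : ℝ × ℝ → ℝ) : Set (ℝ × ℝ) := {x | q2 N x = 0}

/-- Translate of a set of `ℝ²` by a vector. -/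
def transl (a : ℝ × ℝ) (S : Set (ℝ × ℝ)) : Set (ℝ × ℝ) := (a + ·) '' S

/-- The interior of `θ₀` with respect to the `q`-topology. -/
def thetaIntQ (N : ℝ × ℝ → ℝ) : Set (ℝ × ℝ) :=
  @interior _ (ballTop (q2 N)) (theta0 N)

theorem IsCompact.isGreatest_image_of_upperSemicontinuous {X : Type*} [TopologicalSpace X]
    {K : Set X} (hK : IsCompact K) (hne : K.Nonempty) {f : X → ℝ} (hf : UpperSemicontinuous f) :
    IsGreatest (f '' K) (sSup (f '' K)) := by
  obtain ⟨p, hp, hmax⟩ := (hf.upperSemicontinuousOn K).exists_isMaxOn hne hK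
  have h : IsGreatest (f '' K) (f p) := ⟨⟨p, hp, rfl⟩, by rintro _ ⟨x, hx, rfl⟩; exact hmax hx⟩
  rwa [h.csSup_eq]

/-- Lexicographic maximization of two upper semicontinuous functions on a compact set. -/
theorem IsCompact.isGreatest_image_fiber_of_upperSemicontinuous {X : Type*} [TopologicalSpace X]
    {K : Set X} (hK : IsCompact K) (hne : K.Nonempty) {f g : X → ℝ}
    (hf : UpperSemicontinuous f) (hg : UpperSemicontinuous g) :
    IsGreatest (f '' {x ∈ K | g x = sSup (g '' K)})
      (sSup (f '' {x ∈ K | g x = sSup (g '' K)})) := by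
  have hmax := hK.isGreatest_image_of_upperSemicontinuous hne hg
  have hset : {x ∈ K | g x = sSup (g '' K)} = K ∩ g ⁻¹' Set.Ici (sSup (g '' K)) := by
    ext x
    exact and_congr_right fun hx => ⟨fun h => h.ge, fun h => le_antisymm (hmax.2 ⟨x, hx, rfl⟩) h⟩
  obtain ⟨x, hx, hgx⟩ : ∃ x ∈ K, g x = sSup (g '' K) := hmax.1
  have hfiber : IsCompact {x ∈ K | g x = sSup (g '' K)} := by
    rw [hset]
    exact hK.inter_right (hg.isClosed_preimage _)
  exact hfiber.isGreatest_image_of_upperSemicontinuous ⟨x, hx, hgx⟩ hf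

/-- A function dominated by a multiple of `q` along increments is upper semicontinuous
for the topology of `q`. -/
theorem upperSemicontinuous_ballTop {X : Type*} [Sub X] {q f : X → ℝ} {c : ℝ} (hc : 0 < c)
    (h : ∀ x y, (f y - f x) * c ≤ q (y - x)) :
    @UpperSemicontinuous _ ℝ (ballTop q) _ f := by
  let _ : TopologicalSpace X := ballTop q
  refine upperSemicontinuous_iff_isOpen_preimage.2 fun r x hx => ?_
  refine ⟨(r - f x) * c, mul_pos (sub_pos.2 hx) hc, fun y hy => ?_⟩
  have := lt_of_mul_lt_mul_right ((h x y).trans_lt hy) hc.le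
  exact (sub_lt_sub_iff_right _).1 this

/-- If a planar convex set contains a lower quadrant with apex `p`, then it contains the vertical
half-line below any of its points lying strictly to the left of another of its points. -/
theorem Convex.mem_of_le_of_quadrant_subset {K : Set (ℝ × ℝ)} (hK : Convex ℝ K) {p : ℝ × ℝ}
    (hp : Set.Iic p ⊆ K) {a v u b : ℝ} (hav : (a, v) ∈ K) (hub : (u, b) ∈ K) (hau : a < u)
    {y : ℝ} (hy : y ≤ v) : (a, y) ∈ K := by
  suffices h : ∃ z ≤ y, (a, z) ∈ K by
    obtain ⟨z, hzy, hz⟩ := h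
    apply hK.segment_subset hz hav
    rw [← Prod.image_mk_segment_right, segment_eq_Icc (hzy.trans hy)]
    exact ⟨y, ⟨hzy, hy⟩, rfl⟩
  rcases le_or_gt a p.1 with hap | hpa
  · exact ⟨min y p.2, min_le_left _ _, hp ⟨hap, min_le_right _ _⟩⟩
  have hd : 0 < u - p.1 := by linarith
  set t := (a - p.1) / (u - p.1) with ht
  have ht0 : 0 ≤ t := div_nonneg (by linarith) hd.le
  have ht1 : 0 < 1 - t := by
    rw [sub_pos, ht, div_lt_one hd]
    linarith
  have hta : t * (u - p.1) = a - p.1 := div_mul_cancel₀ _ hd.ne'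
  set w := min p.2 ((y - t * b) / (1 - t))
  have hw : (1 - t) * w ≤ y - t * b := by
    rw [mul_comm, ← le_div_iff₀ ht1]
    exact min_le_right _ _
  refine ⟨t * b + (1 - t) * w, by linarith, ?_⟩
  have hmem := hK hub (hp (show (p.1, w) ≤ p from ⟨le_rfl, min_le_left _ _⟩)) ht0 ht1.le
    (by ring)
  convert hmem using 1
  ext
  · simp only [Prod.fst_add, Prod.smul_fst, smul_eq_mul]
    linarith
  · simp

/-- If `K ⊆ ℝ²` is a nonempty `q`-compact convex set with `(α,v) ≠ (u,β)` and nonempty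
`q`-interior, then `co (L₁ ∪ L₂) ⊆ K`, where `L₁ = {(α,y) : y ≤ v}` and `L₂ = {(x,β) : x ≤ u}`. -/
theorem convexHull_halfLines_subset
    (N : ℝ × ℝ → ℝ)
    (hN0 : ∀ x : ℝ × ℝ, N x = 0 ↔ x = 0)
    (hNs : ∀ (c : ℝ) (x : ℝ × ℝ), N (c • x) = |c| * N x)
    (hNt : ∀ x y : ℝ × ℝ, N (x + y) ≤ N x + N y)
    (hNl : ∀ x y : ℝ × ℝ, |x.1| ≤ |y.1| → |x.2| ≤ |y.2| → N x ≤ N y)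
    (K : Set (ℝ × ℝ)) (hne : K.Nonempty) (hconv : Convex ℝ K)
    (hcomp : @IsCompact _ (ballTop (q2 N)) K)
    (u v a b : ℝ)
    (hu : u = sSup (Prod.fst '' K)) (hv : v = sSup (Prod.snd '' K))
    (ha : a = sSup {x : ℝ | (x, v) ∈ K}) (hb : b = sSup {y : ℝ | (u, y) ∈ K})
    (hab : ((a, v) : ℝ × ℝ) ≠ (u, b))
    (hint : (@interior _ (ballTop (q2 N)) K).Nonempty) :
    convexHull ℝ ((({a} : Set ℝ) ×ˢ Set.Iic v) ∪ (Set.Iic u ×ˢ ({b} : Set ℝ))) ⊆ K := by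
  have hN_nonneg : ∀ x, 0 ≤ N x := fun x => by
    have := hNt x (-x)
    have h0 := (hN0 0).2 rfl
    have hneg := hNs (-1) x
    rw [neg_one_smul, abs_neg, abs_one, one_mul] at hneg
    rw [add_neg_cancel, h0, hneg] at this
    linarith
  have hN_pos : ∀ x, x ≠ 0 → 0 < N x := fun x hx =>
    (hN_nonneg x).lt_of_ne' fun h => hx ((hN0 x).1 h)
  have hf : @UpperSemicontinuous _ ℝ (ballTop (q2 N)) _ Prod.fst := by
    refine upperSemicontinuous_ballTop (hN_pos (1, 0) (by simp)) fun x y => ?_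
    calc (y.1 - x.1) * N (1, 0) ≤ |max (y.1 - x.1) 0| * N (1, 0) :=
          mul_le_mul_of_nonneg_right ((le_max_left _ _).trans (le_abs_self _)) (hN_nonneg _)
      _ = N (max (y.1 - x.1) 0 • (1, 0)) := (hNs _ _).symm
      _ ≤ q2 N (y - x) := hNl _ _ (by simp) (by simp)
  have hg : @UpperSemicontinuous _ ℝ (ballTop (q2 N)) _ Prod.snd := by
    refine upperSemicontinuous_ballTop (hN_pos (0, 1) (by simp)) fun x y => ?_
    calc (y.2 - x.2) * N (0, 1) ≤ |max (y.2 - x.2) 0| * N (0, 1) :=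
          mul_le_mul_of_nonneg_right ((le_max_left _ _).trans (le_abs_self _)) (hN_nonneg _)
      _ = N (max (y.2 - x.2) 0 • (0, 1)) := (hNs _ _).symm
      _ ≤ q2 N (y - x) := hNl _ _ (by simp) (by simp)
  have hsv : Prod.fst '' {x ∈ K | x.2 = v} = {x : ℝ | (x, v) ∈ K} := by
    ext; simp
  have hsu : Prod.snd '' {x ∈ K | x.1 = u} = {y : ℝ | (u, y) ∈ K} := by
    ext; simp
  have hmaxu := @IsCompact.isGreatest_image_of_upperSemicontinuous _ (ballTop (q2 N)) K hcomp hne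
    _ hf
  have hmaxv := @IsCompact.isGreatest_image_of_upperSemicontinuous _ (ballTop (q2 N)) K hcomp hne
    _ hg
  have hmaxa := @IsCompact.isGreatest_image_fiber_of_upperSemicontinuous _ (ballTop (q2 N)) K hcomp
    hne _ _ hf hg
  have hmaxb := @IsCompact.isGreatest_image_fiber_of_upperSemicontinuous _ (ballTop (q2 N)) K hcomp
    hne _ _ hg hf
  rw [← hu] at hmaxu
  rw [← hv] at hmaxv
  rw [← hv, hsv, ← ha] at hmaxa
  rw [← hu, hsu, ← hb] at hmaxb
  have hav : (a, v) ∈ K := hmaxa.1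
  have hub : (u, b) ∈ K := hmaxb.1
  have hau : a ≤ u := hmaxu.2 ⟨_, hav, rfl⟩
  have hbv : b ≤ v := hmaxv.2 ⟨_, hub, rfl⟩
  have hau' : a < u := hau.lt_of_ne fun h =>
    hab (Prod.ext h (le_antisymm (hmaxb.2 (h ▸ hav)) hbv))
  have hbv' : b < v := hbv.lt_of_ne fun h =>
    hab (Prod.ext (le_antisymm hau (hmaxa.2 (h ▸ hub))) h.symm)
  obtain ⟨p, hp⟩ := hint
  have hquad : Set.Iic p ⊆ K := fun y hy => by
    obtain ⟨ε, hε, hball⟩ := @isOpen_interior _ (ballTop (q2 N)) K p hp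
    refine @interior_subset _ (ballTop (q2 N)) K _ (hball y ?_)
    have hzero : q2 N (y - p) = 0 := (hN0 _).2 (by simp [hy.1, hy.2])
    rwa [hzero]
  refine convexHull_min ?_ hconv
  rintro ⟨x, y⟩ (⟨hx, hy⟩ | ⟨hx, hy⟩)
  · obtain rfl : x = a := hx
    exact hconv.mem_of_le_of_quadrant_subset hquad hav hub hau' hy
  · obtain rfl : y = b := hy
    have hswap : Convex ℝ (Prod.swap ⁻¹' K) :=
      hconv.is_linear_preimage ⟨fun _ _ => rfl, fun _ _ => rfl⟩
    exact hswap.mem_of_le_of_quadrant_subset (p := p.swap) (fun z hz => hquad ⟨hz.2, hz.1⟩)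
      (a := y) (v := u) (u := v) (b := a) hub hav hbv' hx
end

section
/- Let K ⊆ ℝ² be a nonempty q-compact convex set with (α,v) ≠ (u,β). Then R_K is a convex set that is compact in the Euclidean topology. -/
open Set Pointwise

/-- Euclidean-continuous monotone functions are upper semicontinuous for the `q`-topology. -/
lemma isOpen_ballTop_preimage_Iio {N : ℝ × ℝ → ℝ}
    (hN0 : ∀ x : ℝ × ℝ, N x = 0 ↔ x = 0)
    (hNs : ∀ (c : ℝ) (x : ℝ × ℝ), N (c • x) = |c| * N x)
    (hNl : ∀ x y : ℝ × ℝ, |x.1| ≤ |y.1| → |x.2| ≤ |y.2| → N x ≤ N y)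
    {f : ℝ × ℝ → ℝ} (hf : Continuous f) (hm : Monotone f) (c : ℝ) :
    @IsOpen _ (ballTop (q2 N)) (f ⁻¹' Iio c) := by
  have hpos : ∀ x : ℝ × ℝ, x ≠ 0 → 0 < N x := fun x hx =>
    lt_of_le_of_ne ((hN0 0).2 rfl ▸ hNl 0 x (by simp) (by simp)) fun h => hx ((hN0 x).1 h.symm)
  have h₁ : 0 < N (1, 0) := hpos _ (by simp)
  have h₂ : 0 < N (0, 1) := hpos _ (by simp)
  have hq₁ : ∀ z : ℝ × ℝ, z.1 * N (1, 0) ≤ q2 N z := fun z => by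
    have h := hNl (max z.1 0 • ((1, 0) : ℝ × ℝ)) (max z.1 0, max z.2 0) (by simp) (by simp)
    rw [hNs, abs_of_nonneg (le_max_right _ _)] at h
    exact (mul_le_mul_of_nonneg_right (le_max_left _ _) h₁.le).trans h
  have hq₂ : ∀ z : ℝ × ℝ, z.2 * N (0, 1) ≤ q2 N z := fun z => by
    have h := hNl (max z.2 0 • ((0, 1) : ℝ × ℝ)) (max z.1 0, max z.2 0) (by simp) (by simp)
    rw [hNs, abs_of_nonneg (le_max_right _ _)] at h
    exact (mul_le_mul_of_nonneg_right (le_max_left _ _) h₂.le).trans h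
  intro x hx
  obtain ⟨δ, hδ, hball⟩ := Metric.isOpen_iff.1 (isOpen_Iio.preimage hf) x hx
  have hmem : f (x.1 + δ / 2, x.2 + δ / 2) < c := by
    refine hball ?_
    rw [Metric.mem_ball, Prod.dist_eq, max_lt_iff, Real.dist_eq, Real.dist_eq]
    simp only [add_sub_cancel_left]
    rw [abs_of_pos (half_pos hδ)]
    exact ⟨half_lt_self hδ, half_lt_self hδ⟩
  refine ⟨min (δ / 2 * N (1, 0)) (δ / 2 * N (0, 1)), by positivity, fun y hy => ?_⟩
  have hy₁ := lt_of_mul_lt_mul_right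
    ((hq₁ (y - x)).trans_lt (hy.trans_le (min_le_left _ _))) h₁.le
  have hy₂ := lt_of_mul_lt_mul_right
    ((hq₂ (y - x)).trans_lt (hy.trans_le (min_le_right _ _))) h₂.le
  simp only [Prod.fst_sub, Prod.snd_sub] at hy₁ hy₂
  refine (hm (Prod.mk_le_mk.2 ⟨?_, ?_⟩ : (y.1, y.2) ≤ _)).trans_lt hmem <;> linarith

/-- A point below `k` and above the line through `(a, v)` and `(u, b)` lies in every convex set
containing `(a, v)`, `(u, b)` and `k`, provided `k ≤ (u, v)`. -/
lemma Convex.mem_of_le_of_above_line {K : Set (ℝ × ℝ)} (hK : Convex ℝ K) {u v a b : ℝ}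
    (hau : a < u) (hbv : b < v) (hA : (a, v) ∈ K) (hB : (u, b) ∈ K) {k p : ℝ × ℝ} (hk : k ∈ K)
    (hku : k.1 ≤ u) (hkv : k.2 ≤ v) (hpk : p ≤ k)
    (hp : (p.2 - b) * (a - u) ≤ (p.1 - u) * (v - b)) : p ∈ K := by
  obtain ⟨hp₁, hp₂⟩ := hpk
  have hd : 0 < u - a := sub_pos.2 hau
  have he : 0 < v - b := sub_pos.2 hbv
  set l : ℝ × ℝ → ℝ := fun z => (v - b) * (z.1 - u) + (u - a) * (z.2 - b) with hl
  have hlp : 0 ≤ l p := by simp only [hl]; linarith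
  have h₁ : (v - b) * p.1 ≤ (v - b) * k.1 := mul_le_mul_of_nonneg_left hp₁ he.le
  have h₂ : (u - a) * p.2 ≤ (u - a) * k.2 := mul_le_mul_of_nonneg_left hp₂ hd.le
  have hlk : l p ≤ l k := by simp only [hl]; linarith
  rcases (hlp.trans hlk).eq_or_lt with h0 | h0
  · have hpk : p = k := by
      simp only [hl] at hlp h0
      refine Prod.ext (mul_left_cancel₀ he.ne' ?_) (mul_left_cancel₀ hd.ne' ?_) <;> linarith
    exact hpk ▸ hk
  · obtain ⟨t, ht⟩ : ∃ t, t = l p / l k := ⟨_, rfl⟩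
    have ht0 : 0 ≤ t := ht ▸ div_nonneg hlp h0.le
    have ht1 : t ≤ 1 := ht ▸ (div_le_one h0).2 hlk
    have htl : t * l k = l p := by rw [ht]; field_simp
    simp only [hl] at htl
    have hs : 0 ≤ ((1 - t) * u - p.1 + t * k.1) / (u - a) :=
      div_nonneg (by nlinarith) hd.le
    have hr : 0 ≤ ((1 - t) * v - p.2 + t * k.2) / (v - b) :=
      div_nonneg (by nlinarith) he.le
    have hsum : ((1 - t) * u - p.1 + t * k.1) / (u - a)
        + ((1 - t) * v - p.2 + t * k.2) / (v - b) = 1 - t := by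
      rw [div_add_div _ _ hd.ne' he.ne', div_eq_iff (mul_pos hd he).ne']
      linear_combination htl
    have hs' : ((1 - t) * u - p.1 + t * k.1) / (u - a) * (u - a) = (1 - t) * u - p.1 + t * k.1 :=
      div_mul_cancel₀ _ hd.ne'
    have hr' : ((1 - t) * v - p.2 + t * k.2) / (v - b) * (v - b) = (1 - t) * v - p.2 + t * k.2 :=
      div_mul_cancel₀ _ he.ne'
    generalize ((1 - t) * u - p.1 + t * k.1) / (u - a) = s at *
    generalize ((1 - t) * v - p.2 + t * k.2) / (v - b) = r at *
    have hp : p = s • (a, v) + r • (u, b) + t • k := by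
      ext
      · simp only [Prod.fst_add, Prod.smul_fst, smul_eq_mul]
        linear_combination hs' - u * hsum
      · simp only [Prod.snd_add, Prod.smul_snd, smul_eq_mul]
        linear_combination hr' - v * hsum
    rw [hp]
    have h := hK.sum_mem (t := Finset.univ) (w := ![s, r, t]) (z := ![(a, v), (u, b), k])
      (by intro i _; fin_cases i <;> simpa)
      (by rw [Fin.sum_univ_three]; change s + r + t = 1; linarith)
      (by intro i _; fin_cases i <;> simpa)
    rw [Fin.sum_univ_three] at h
    exact h

/-- For a nonempty `q`-compact convex set `K ⊆ ℝ²` with `(α,v) ≠ (u,β)`, the set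
`R_K = K ∩ H` is convex and compact in the Euclidean topology. -/
theorem RK_convex_compact
    (N : ℝ × ℝ → ℝ)
    (hN0 : ∀ x : ℝ × ℝ, N x = 0 ↔ x = 0)
    (hNs : ∀ (c : ℝ) (x : ℝ × ℝ), N (c • x) = |c| * N x)
    (hNt : ∀ x y : ℝ × ℝ, N (x + y) ≤ N x + N y)
    (hNl : ∀ x y : ℝ × ℝ, |x.1| ≤ |y.1| → |x.2| ≤ |y.2| → N x ≤ N y)
    (K : Set (ℝ × ℝ)) (hne : K.Nonempty) (hconv : Convex ℝ K)
    (hcomp : @IsCompact _ (ballTop (q2 N)) K)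
    (u v a b : ℝ)
    (hu : u = sSup (Prod.fst '' K)) (hv : v = sSup (Prod.snd '' K))
    (ha : a = sSup {x : ℝ | (x, v) ∈ K}) (hb : b = sSup {y : ℝ | (u, y) ∈ K})
    (hab : ((a, v) : ℝ × ℝ) ≠ (u, b))
    (R : Set (ℝ × ℝ))
    (hR : R = K ∩ {p : ℝ × ℝ | (p.2 - b) * (a - u) ≤ (p.1 - u) * (v - b)}) :
    Convex ℝ R ∧ IsCompact R := by
  have husc : ∀ {f : ℝ × ℝ → ℝ}, Continuous f → Monotone f →
      @UpperSemicontinuous _ _ (ballTop (q2 N)) _ f := fun hf hm =>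
    (@upperSemicontinuous_iff_isOpen_preimage _ _ (ballTop (q2 N)) _ _).2
      (isOpen_ballTop_preimage_Iio hN0 hNs hNl hf hm)
  have hmax : ∀ {f : ℝ × ℝ → ℝ} {S : Set (ℝ × ℝ)}, Continuous f → Monotone f →
      @IsCompact _ (ballTop (q2 N)) S → S.Nonempty → ∃ x ∈ S, ∀ y ∈ S, f y ≤ f x :=
    fun hf hm hS hne => @UpperSemicontinuousOn.exists_isMaxOn _ (ballTop (q2 N)) _ _ _ _ hne hS
      (@UpperSemicontinuous.upperSemicontinuousOn _ _ (ballTop (q2 N)) _ _ (husc hf hm) _)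
  have hinter : ∀ {f : ℝ × ℝ → ℝ} {S : Set (ℝ × ℝ)} (c : ℝ), Continuous f → Monotone f →
      @IsCompact _ (ballTop (q2 N)) S → @IsCompact _ (ballTop (q2 N)) (S ∩ f ⁻¹' Ici c) :=
    fun c hf hm hS => @IsCompact.inter_right _ (ballTop (q2 N)) _ _ hS
      (@UpperSemicontinuous.isClosed_preimage _ (ballTop (q2 N)) _ _ _ (husc hf hm) c)
  obtain ⟨x, hxK, hx⟩ := hmax continuous_fst monotone_fst hcomp hne
  obtain ⟨y, hyK, hy⟩ := hmax continuous_snd monotone_snd hcomp hne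
  have hux : u = x.1 := hu.trans (IsGreatest.csSup_eq
    ⟨mem_image_of_mem _ hxK, forall_mem_image.2 hx⟩)
  have hvy : v = y.2 := hv.trans (IsGreatest.csSup_eq
    ⟨mem_image_of_mem _ hyK, forall_mem_image.2 hy⟩)
  rw [← hux] at hx
  rw [← hvy] at hy
  obtain ⟨⟨x', v'⟩, ⟨hAK, hA₂⟩, hA⟩ := hmax continuous_fst monotone_fst
    (hinter v continuous_snd monotone_snd hcomp) ⟨y, hyK, hvy.le⟩
  obtain ⟨⟨u', y'⟩, ⟨hBK, hB₂⟩, hB⟩ := hmax continuous_snd monotone_snd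
    (hinter u continuous_fst monotone_fst hcomp) ⟨x, hxK, hux.le⟩
  obtain rfl : v' = v := le_antisymm (hy _ hAK) hA₂
  obtain rfl : u' = u := le_antisymm (hx _ hBK) hB₂
  have hA' : IsGreatest {x : ℝ | (x, v') ∈ K} a := by
    have h : IsGreatest {x : ℝ | (x, v') ∈ K} x' := ⟨hAK, fun z hz => hA (z, v') ⟨hz, by simp⟩⟩
    rwa [ha, h.csSup_eq]
  have hB' : IsGreatest {y : ℝ | (u', y) ∈ K} b := by
    have h : IsGreatest {y : ℝ | (u', y) ∈ K} y' := ⟨hBK, fun z hz => hB (u', z) ⟨hz, by simp⟩⟩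
    rwa [hb, h.csSup_eq]
  have hau : a < u' := lt_of_le_of_ne (hx _ hA'.1) fun h => hab <| by
    rw [h, le_antisymm (hB'.2 (show (u', v') ∈ K from h ▸ hA'.1)) (hy _ hB'.1)]
  have hbv : b < v' := lt_of_le_of_ne (hy _ hB'.1) fun h => hab <| by
    rw [h, le_antisymm (hA'.2 (show (u', v') ∈ K from h ▸ hB'.1)) (hx _ hA'.1)]
  have hlm : Monotone fun p : ℝ × ℝ => (p.1 - u') * (v' - b) - (p.2 - b) * (a - u') :=
    fun p p' hpp => by
      have h₁ := mul_le_mul_of_nonneg_right hpp.1 (sub_nonneg.2 hbv.le)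
      have h₂ := mul_le_mul_of_nonneg_right hpp.2 (sub_nonneg.2 hau.le)
      simp only
      linarith
  have hRq : @IsCompact _ (ballTop (q2 N)) R := by
    convert hinter 0 (by fun_prop) hlm hcomp using 1
    ext p
    simp [hR]
  refine ⟨?_, ?_⟩
  · rw [hR]
    refine hconv.inter fun p hp p' hp' s t hs ht hst => ?_
    have h₁ := mul_le_mul_of_nonneg_left (mem_ofPred.1 hp) hs
    have h₂ := mul_le_mul_of_nonneg_left (mem_ofPred.1 hp') ht
    obtain rfl : s = 1 - t := by linarith
    simp only [mem_ofPred_eq, Prod.fst_add, Prod.snd_add, Prod.smul_fst, Prod.smul_snd, smul_eq_mul]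
    linarith
  have hRH : ∀ p ∈ R, (p.2 - b) * (a - u') ≤ (p.1 - u') * (v' - b) := fun p hp =>
    (hR ▸ hp : p ∈ K ∩ _).2
  have hRK : ∀ p ∈ R, p ∈ K := fun p hp => (hR ▸ hp : p ∈ K ∩ _).1
  refine (isCompact_Icc (a := (a, b)) (b := (u', v'))).of_isClosed_subset ?_ fun p hp => ?_
  · refine isClosed_of_closure_subset fun p hp => ?_
    have hpH : (p.2 - b) * (a - u') ≤ (p.1 - u') * (v' - b) :=
      closure_minimal (t := {p : ℝ × ℝ | (p.2 - b) * (a - u') ≤ (p.1 - u') * (v' - b)}) hRH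
        (isClosed_le (by fun_prop) (by fun_prop)) hp
    obtain ⟨k, hkR, hk⟩ := hmax (f := fun z : ℝ × ℝ => min (z.1 - p.1) (z.2 - p.2))
      (by fun_prop) (fun z z' h => min_le_min (sub_le_sub_right h.1 _) (sub_le_sub_right h.2 _))
      hRq (closure_nonempty_iff.1 ⟨p, hp⟩)
    have hpk := closure_minimal
      (t := {z : ℝ × ℝ | min (z.1 - p.1) (z.2 - p.2) ≤ min (k.1 - p.1) (k.2 - p.2)}) hk
      (isClosed_le (by fun_prop) (by fun_prop)) hp
    simp only [mem_ofPred_eq, sub_self, min_self, le_min_iff, sub_nonneg] at hpk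
    rw [hR]
    exact ⟨hconv.mem_of_le_of_above_line hau hbv hA'.1 hB'.1 (hRK k hkR) (hx _ (hRK k hkR))
      (hy _ (hRK k hkR)) hpk hpH, hpH⟩
  · have hpu := hx p (hRK p hp)
    have hpv := hy p (hRK p hp)
    have hpH := hRH p hp
    refine ⟨⟨?_, ?_⟩, hpu, hpv⟩
    · by_contra! h
      simp only at h
      nlinarith [mul_pos (sub_pos.2 h) (sub_pos.2 hbv),
        mul_nonneg (sub_nonneg.2 hpv) (sub_nonneg.2 hau.le)]
    · by_contra! h
      simp only at h
      nlinarith [mul_pos (sub_pos.2 h) (sub_pos.2 hau),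
        mul_nonneg (sub_nonneg.2 hpu) (sub_nonneg.2 hbv.le)]
end

section
/- Let K ⊆ ℝ² be a q-compact convex body. Then one of the following holds. (1) There exist (u,v) ∈ ℝ², t₀ ∈ [−∞, v], s₀ ∈ [−∞, u], a set V that is either {u} × (t₀, v] or {u} × [t₀, v] (the latter only if t₀ > −∞), and a set W that is either {(s, v) : s₀ < s ≤ u} or {(s, v) : s₀ ≤ s ≤ u} (the latter only if s₀ > −∞), such that K = V ∪ W ∪ ((u,v) + int_q(θ₀)). (2) There exist real numbers α < u, β < v, extended reals s₀ ∈ [−∞, α], t₀ ∈ [−∞, β], a convex set K₀ compact in the Euclidean topology with co{(α,v),(α,β),(u,β)} ⊆ K₀ ⊆ co{(α,v),(α,β),(u,β),(u,v)} and K₀ ⊆ K ⊆ K₀ + θ₀, a set V that is either {u} × (t₀, β] or {u} × [t₀, β], and a set W that is either {(s, v) : s₀ < s ≤ α} or {(s, v) : s₀ ≤ s ≤ α}, such that K = K₀ ∪ ((α,v) + int_q(θ₀)) ∪ ((u,β) + int_q(θ₀)) ∪ V ∪ W. -/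
open Set Pointwise

/-- The possible forms of the vertical piece `V`: either `{u} × (t₀, c]` for a real `t₀ ≤ c`,
or `{u} × [t₀, c]` for a real `t₀ ≤ c`, or (the case `t₀ = -∞`) `{u} × (-∞, c]`. -/
def Vform (u c : ℝ) (V : Set (ℝ × ℝ)) : Prop :=
  (∃ t₀ : ℝ, t₀ ≤ c ∧ V = ({u} : Set ℝ) ×ˢ Set.Ioc t₀ c) ∨
  (∃ t₀ : ℝ, t₀ ≤ c ∧ V = ({u} : Set ℝ) ×ˢ Set.Icc t₀ c) ∨
  V = ({u} : Set ℝ) ×ˢ Set.Iic c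

/-- The possible forms of the horizontal piece `W`: either `(s₀, e] × {v}` for a real `s₀ ≤ e`,
or `[s₀, e] × {v}` for a real `s₀ ≤ e`, or (the case `s₀ = -∞`) `(-∞, e] × {v}`. -/
def Wform (v e : ℝ) (W : Set (ℝ × ℝ)) : Prop :=
  (∃ s₀ : ℝ, s₀ ≤ e ∧ W = Set.Ioc s₀ e ×ˢ ({v} : Set ℝ)) ∨
  (∃ s₀ : ℝ, s₀ ≤ e ∧ W = Set.Icc s₀ e ×ˢ ({v} : Set ℝ)) ∨
  W = Set.Iic e ×ˢ ({v} : Set ℝ)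

open scoped Topology

lemma exists_add_mem_of_isOpen {U : Set (ℝ × ℝ)} (hU : IsOpen U) {x : ℝ × ℝ} (hx : x ∈ U) :
    ∃ δ > 0, (x.1 + δ, x.2 + δ) ∈ U := by
  obtain ⟨δ, hδ, h⟩ := Metric.isOpen_iff.1 hU x hx
  refine ⟨δ / 2, half_pos hδ, h ?_⟩
  rw [Metric.mem_ball, Prod.dist_eq, Real.dist_eq, Real.dist_eq, add_sub_cancel_left,
    add_sub_cancel_left, max_self, abs_of_pos (half_pos hδ)]
  exact half_lt_self hδ

/-- The `q2 N`-topology consists of the lower sets that are open in the usual topology. -/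
lemma isOpen_ballTop_q2_iff {N : ℝ × ℝ → ℝ} (hN0 : ∀ x : ℝ × ℝ, N x = 0 ↔ x = 0)
    (hNs : ∀ (c : ℝ) (x : ℝ × ℝ), N (c • x) = |c| * N x)
    (hNl : ∀ x y : ℝ × ℝ, |x.1| ≤ |y.1| → |x.2| ≤ |y.2| → N x ≤ N y) {U : Set (ℝ × ℝ)} :
    IsOpen[ballTop (q2 N)] U ↔ IsOpen U ∧ IsLowerSet U := by
  have hz : N 0 = 0 := (hN0 0).2 rfl
  have hpos : ∀ x, x ≠ 0 → 0 < N x := fun x hx =>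
    lt_of_le_of_ne (hz ▸ hNl 0 x (by simp) (by simp)) fun h => hx ((hN0 x).1 h.symm)
  constructor
  · intro hU
    constructor
    · rw [Metric.isOpen_iff]
      intro x hx
      obtain ⟨ε, hε, h⟩ := hU x hx
      have h1 := hpos (1, 1) (by simp)
      refine ⟨ε / N (1, 1), by positivity, fun y hy => h y ?_⟩
      rw [Metric.mem_ball, lt_div_iff₀ h1] at hy
      refine lt_of_le_of_lt ?_ hy
      rw [← abs_of_nonneg (dist_nonneg (x := y) (y := x)), ← hNs]
      have hd : |y.1 - x.1| ≤ dist y x ∧ |y.2 - x.2| ≤ dist y x := by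
        rw [Prod.dist_eq, Real.dist_eq, Real.dist_eq]
        exact ⟨le_max_left _ _, le_max_right _ _⟩
      apply hNl
      · simp only [Prod.fst_sub, Prod.smul_fst, smul_eq_mul, mul_one]
        rw [abs_of_nonneg (le_max_right _ _), abs_of_nonneg dist_nonneg]
        exact max_le ((le_abs_self _).trans hd.1) dist_nonneg
      · simp only [Prod.snd_sub, Prod.smul_snd, smul_eq_mul, mul_one]
        rw [abs_of_nonneg (le_max_right _ _), abs_of_nonneg dist_nonneg]
        exact max_le ((le_abs_self _).trans hd.2) dist_nonneg
    · intro x y hyx hx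
      obtain ⟨ε, hε, h⟩ := hU x hx
      refine h y ?_
      rw [q2, Prod.fst_sub, Prod.snd_sub, max_eq_right (sub_nonpos.2 hyx.1),
        max_eq_right (sub_nonpos.2 hyx.2)]
      exact hz.trans_lt hε
  · rintro ⟨hU, hl⟩ x hx
    obtain ⟨δ, hδ, h⟩ := exists_add_mem_of_isOpen hU hx
    have h1 := hpos (1, 0) (by simp)
    have h2 := hpos (0, 1) (by simp)
    refine ⟨δ * min (N (1, 0)) (N (0, 1)), by positivity, fun y hy => ?_⟩
    refine hl (show y ≤ (x.1 + δ, x.2 + δ) from ⟨?_, ?_⟩) h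
    · by_contra! hlt
      have hb := hNl (δ • (1, 0)) (max (y - x).1 0, max (y - x).2 0)
        (by
          simp only [Prod.fst_sub, Prod.smul_fst, smul_eq_mul, mul_one]
          rw [abs_of_pos hδ, abs_of_nonneg (le_max_right _ _)]
          exact le_max_of_le_left (by linarith)) (by simp)
      rw [hNs, abs_of_pos hδ] at hb
      exact absurd (hy.trans_le (mul_le_mul_of_nonneg_left (min_le_left _ _) hδ.le))
        (not_lt.2 hb)
    · by_contra! hlt
      have hb := hNl (δ • (0, 1)) (max (y - x).1 0, max (y - x).2 0) (by simp)
        (by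
          simp only [Prod.snd_sub, Prod.smul_snd, smul_eq_mul, mul_one]
          rw [abs_of_pos hδ, abs_of_nonneg (le_max_right _ _)]
          exact le_max_of_le_left (by linarith))
      rw [hNs, abs_of_pos hδ] at hb
      exact absurd (hy.trans_le (mul_le_mul_of_nonneg_left (min_le_right _ _) hδ.le))
        (not_lt.2 hb)

lemma mem_theta0_iff {N : ℝ × ℝ → ℝ} (hN0 : ∀ x : ℝ × ℝ, N x = 0 ↔ x = 0) {x : ℝ × ℝ} :
    x ∈ theta0 N ↔ x ≤ 0 := by
  simp [theta0, q2, hN0, Prod.le_def]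

lemma thetaIntQ_eq {N : ℝ × ℝ → ℝ} (hN0 : ∀ x : ℝ × ℝ, N x = 0 ↔ x = 0)
    (hopen : ∀ U : Set (ℝ × ℝ), IsOpen[ballTop (q2 N)] U ↔ IsOpen U ∧ IsLowerSet U) :
    thetaIntQ N = Iio 0 ×ˢ Iio 0 := by
  let _ := ballTop (q2 N)
  apply Subset.antisymm
  · intro x hx
    obtain ⟨U, hUθ, hU, hxU⟩ := mem_interior.1 hx
    obtain ⟨δ, hδ, h⟩ := exists_add_mem_of_isOpen ((hopen U).1 hU).1 hxU
    have h' := (mem_theta0_iff hN0).1 (hUθ h)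
    have h1 : x.1 + δ ≤ 0 := h'.1
    have h2 : x.2 + δ ≤ 0 := h'.2
    exact ⟨by rw [mem_Iio]; linarith, by rw [mem_Iio]; linarith⟩
  · refine interior_maximal (fun x hx => (mem_theta0_iff hN0).2 ⟨hx.1.le, hx.2.le⟩)
      ((hopen _).2 ⟨isOpen_Iio.prod isOpen_Iio, ?_⟩)
    exact fun x y hyx hx => ⟨hyx.1.trans_lt hx.1, hyx.2.trans_lt hx.2⟩

lemma mem_transl_thetaIntQ_iff {N : ℝ × ℝ → ℝ} (hN0 : ∀ x : ℝ × ℝ, N x = 0 ↔ x = 0)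
    (hopen : ∀ U : Set (ℝ × ℝ), IsOpen[ballTop (q2 N)] U ↔ IsOpen U ∧ IsLowerSet U)
    {a x : ℝ × ℝ} : x ∈ transl a (thetaIntQ N) ↔ x.1 < a.1 ∧ x.2 < a.2 := by
  simp [transl, thetaIntQ_eq hN0 hopen, neg_add_lt_iff_lt_add]

lemma exists_forall_le_of_monotone {q : ℝ × ℝ → ℝ}
    (hopen : ∀ U : Set (ℝ × ℝ), IsOpen[ballTop q] U ↔ IsOpen U ∧ IsLowerSet U)
    {K : Set (ℝ × ℝ)} (hK : @IsCompact _ (ballTop q) K) (hne : K.Nonempty) {f : ℝ × ℝ → ℝ}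
    (hf : Continuous f) (hm : Monotone f) : ∃ k ∈ K, ∀ p ∈ K, f p ≤ f k := by
  have husc : @UpperSemicontinuous _ _ (ballTop q) _ f :=
    (@upperSemicontinuous_iff_isOpen_preimage _ _ (ballTop q) _ _).2 fun y =>
      (hopen _).2 ⟨isOpen_Iio.preimage hf, fun _ _ hab ha => (hm hab).trans_lt ha⟩
  exact @UpperSemicontinuousOn.exists_isMaxOn _ (ballTop q) _ _ _ _ hne hK
    (@UpperSemicontinuous.upperSemicontinuousOn _ _ (ballTop q) _ _ husc K)

lemma Set.OrdConnected.eq_of_isGreatest {T : Set ℝ} {c : ℝ} (hT : T.OrdConnected)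
    (hc : IsGreatest T c) :
    (∃ t ≤ c, T = Ioc t c) ∨ (∃ t ≤ c, T = Icc t c) ∨ T = Iic c := by
  by_cases hb : BddBelow T
  · have hle : sInf T ≤ c := csInf_le hb hc.1
    by_cases hi : sInf T ∈ T
    · exact Or.inr (Or.inl ⟨sInf T, hle, Subset.antisymm
        (fun x hx => ⟨csInf_le hb hx, hc.2 hx⟩) (hT.out hi hc.1)⟩)
    · refine Or.inl ⟨sInf T, hle, Subset.antisymm (fun x hx => ⟨?_, hc.2 hx⟩) fun x hx => ?_⟩
      · exact lt_of_le_of_ne (csInf_le hb hx) fun h => hi (h ▸ hx)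
      · obtain ⟨y, hy, hyx⟩ := exists_lt_of_csInf_lt ⟨c, hc.1⟩ hx.1
        exact hT.out hy hc.1 ⟨hyx.le, hx.2⟩
  · refine Or.inr (Or.inr (Subset.antisymm (fun x hx => hc.2 hx) fun x hx => ?_))
    obtain ⟨y, hy, hyx⟩ := not_bddBelow_iff.1 hb x
    exact hT.out hy hc.1 ⟨hyx.le, hx⟩

lemma vform_of_convex {K : Set (ℝ × ℝ)} (hconv : Convex ℝ K) {u c : ℝ} (hc : (u, c) ∈ K)
    (hle : ∀ t, (u, t) ∈ K → t ≤ c) : Vform u c {p ∈ K | p.1 = u} := by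
  have hV : {p ∈ K | p.1 = u} = {u} ×ˢ {t | (u, t) ∈ K} := by
    ext ⟨x, y⟩
    simp only [mem_ofPred_eq, mem_prod, mem_singleton_iff]
    exact ⟨fun h => ⟨h.2, h.2 ▸ h.1⟩, fun h => ⟨h.1 ▸ h.2, h.1⟩⟩
  have hT : Convex ℝ {t | (u, t) ∈ K} := by
    intro x hx y hy s t hs ht hst
    have h := hconv hx hy hs ht hst
    simpa [← add_mul, hst] using h
  rw [hV]
  rcases hT.ordConnected.eq_of_isGreatest ⟨hc, hle⟩ with ⟨t, ht, h⟩ | ⟨t, ht, h⟩ | h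
  · exact Or.inl ⟨t, ht, by rw [h]⟩
  · exact Or.inr (Or.inl ⟨t, ht, by rw [h]⟩)
  · exact Or.inr (Or.inr (by rw [h]))

lemma wform_of_convex {K : Set (ℝ × ℝ)} (hconv : Convex ℝ K) {v e : ℝ} (he : (e, v) ∈ K)
    (hle : ∀ s, (s, v) ∈ K → s ≤ e) : Wform v e {p ∈ K | p.2 = v} := by
  have hW : {p ∈ K | p.2 = v} = {s | (s, v) ∈ K} ×ˢ {v} := by
    ext ⟨x, y⟩
    simp only [mem_ofPred_eq, mem_prod, mem_singleton_iff]
    exact ⟨fun h => ⟨h.2 ▸ h.1, h.2⟩, fun h => ⟨h.2 ▸ h.1, h.2⟩⟩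
  have hT : Convex ℝ {s | (s, v) ∈ K} := by
    intro x hx y hy s t hs ht hst
    have h := hconv hx hy hs ht hst
    simpa [← add_mul, hst] using h
  rw [hW]
  rcases hT.ordConnected.eq_of_isGreatest ⟨he, hle⟩ with ⟨t, ht, h⟩ | ⟨t, ht, h⟩ | h
  · exact Or.inl ⟨t, ht, by rw [h]⟩
  · exact Or.inr (Or.inl ⟨t, ht, by rw [h]⟩)
  · exact Or.inr (Or.inr (by rw [h]))

/-- A convex set containing a lower quadrant contains every point lying strictly below one of its
points. -/
lemma Convex.mem_of_lt_of_lt {K : Set (ℝ × ℝ)} (hconv : Convex ℝ K) {x : ℝ × ℝ} (hx : Iic x ⊆ K)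
    {p k : ℝ × ℝ} (hk : k ∈ K) (h1 : p.1 < k.1) (h2 : p.2 < k.2) : p ∈ K := by
  obtain ⟨n, hn⟩ := exists_nat_gt
    (max 1 (max ((k.1 - x.1) / (k.1 - p.1)) ((k.2 - x.2) / (k.2 - p.2))))
  simp only [max_lt_iff] at hn
  obtain ⟨hn0, hn1, hn2⟩ := hn
  rw [div_lt_iff₀ (sub_pos.2 h1)] at hn1
  rw [div_lt_iff₀ (sub_pos.2 h2)] at hn2
  have hfar : k + (n : ℝ) • (p - k) ∈ K := by
    apply hx
    constructor
    · simp only [Prod.fst_add, Prod.smul_fst, Prod.fst_sub, smul_eq_mul]; linarith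
    · simp only [Prod.snd_add, Prod.smul_snd, Prod.snd_sub, smul_eq_mul]; linarith
  have hpos : (0 : ℝ) < n := zero_lt_one.trans hn0
  have h := hconv.add_smul_sub_mem hk hfar
    (t := (n : ℝ)⁻¹) ⟨by positivity, inv_le_one_of_one_le₀ hn0.le⟩
  rwa [add_sub_cancel_left, smul_smul, inv_mul_cancel₀ hpos.ne', one_smul,
    add_sub_cancel] at h

lemma exists_pos_lt_add_mul {y c : ℝ} (d : ℝ) (hy : y < c) :
    ∃ ε : ℝ, 0 < ε ∧ ε ≤ 1 ∧ y < c + ε * d := by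
  have hcont : Filter.Tendsto (fun ε : ℝ => c + ε * d) (nhdsWithin 0 (Ioi 0))
      (nhds (c + 0 * d)) :=
    (Continuous.tendsto (by fun_prop) 0).mono_left nhdsWithin_le_nhds
  obtain ⟨ε, h, h'⟩ := ((hcont.eventually_const_lt (u := y) (by simpa using hy)).and
    (Ioc_mem_nhdsGT (zero_lt_one' ℝ))).exists
  exact ⟨ε, h'.1, h'.2, h⟩

lemma Convex.exists_mem_fst_lt_and_lt_snd {K : Set (ℝ × ℝ)} (hconv : Convex ℝ K) {k m : ℝ × ℝ}
    (hk : k ∈ K) (hm : m ∈ K) {y : ℝ} (hy : y < k.2) (hkm : k.1 < m.1) :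
    ∃ r ∈ K, k.1 < r.1 ∧ y < r.2 := by
  obtain ⟨ε, hε, hε1, h⟩ := exists_pos_lt_add_mul (m.2 - k.2) hy
  exact ⟨_, hconv.add_smul_sub_mem hk hm ⟨hε.le, hε1⟩,
    by simpa using mul_pos hε (sub_pos.2 hkm), by simpa using h⟩

lemma Convex.exists_mem_lt_fst_and_snd_lt {K : Set (ℝ × ℝ)} (hconv : Convex ℝ K) {k m : ℝ × ℝ}
    (hk : k ∈ K) (hm : m ∈ K) {x : ℝ} (hx : x < k.1) (hkm : k.2 < m.2) :
    ∃ r ∈ K, x < r.1 ∧ k.2 < r.2 := by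
  obtain ⟨ε, hε, hε1, h⟩ := exists_pos_lt_add_mul (m.1 - k.1) hx
  exact ⟨_, hconv.add_smul_sub_mem hk hm ⟨hε.le, hε1⟩,
    by simpa using h, by simpa using mul_pos hε (sub_pos.2 hkm)⟩

/-- Structure theorem for `q`-compact convex bodies in `ℝ²` (necessity). -/
theorem qCompact_convex_body_structure
    (N : ℝ × ℝ → ℝ)
    (hN0 : ∀ x : ℝ × ℝ, N x = 0 ↔ x = 0)
    (hNs : ∀ (c : ℝ) (x : ℝ × ℝ), N (c • x) = |c| * N x)
    (hNt : ∀ x y : ℝ × ℝ, N (x + y) ≤ N x + N y)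
    (hNl : ∀ x y : ℝ × ℝ, |x.1| ≤ |y.1| → |x.2| ≤ |y.2| → N x ≤ N y)
    (K : Set (ℝ × ℝ)) (hconv : Convex ℝ K)
    (hcomp : @IsCompact _ (ballTop (q2 N)) K)
    (hbody : (@interior _ (ballTop (q2 N)) K).Nonempty) :
    (∃ u v : ℝ, ∃ V W : Set (ℝ × ℝ), Vform u v V ∧ Wform v u W ∧
      K = V ∪ W ∪ transl (u, v) (thetaIntQ N)) ∨
    (∃ a u b v : ℝ, a < u ∧ b < v ∧
      ∃ K₀ : Set (ℝ × ℝ), Convex ℝ K₀ ∧ IsCompact K₀ ∧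
        convexHull ℝ ({(a, v), (a, b), (u, b)} : Set (ℝ × ℝ)) ⊆ K₀ ∧
        K₀ ⊆ convexHull ℝ ({(a, v), (a, b), (u, b), (u, v)} : Set (ℝ × ℝ)) ∧
        K₀ ⊆ K ∧ K ⊆ K₀ + theta0 N ∧
        ∃ V W : Set (ℝ × ℝ), Vform u b V ∧ Wform v a W ∧
          K = K₀ ∪ transl (a, v) (thetaIntQ N) ∪ transl (u, b) (thetaIntQ N) ∪ V ∪ W) := by
  have hopen := fun U => isOpen_ballTop_q2_iff hN0 hNs hNl (U := U)
  obtain ⟨x, hx⟩ : ∃ x, Iic x ⊆ K := by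
    obtain ⟨x, hx⟩ := hbody
    obtain ⟨U, hUK, hU, hxU⟩ := (@mem_interior _ (ballTop (q2 N)) _ _).1 hx
    exact ⟨x, fun y hy => hUK (((hopen U).1 hU).2 hy hxU)⟩
  have hne : K.Nonempty := ⟨x, hx (mem_Iic.2 le_rfl)⟩
  have hbelow : ∀ {p k : ℝ × ℝ}, k ∈ K → p.1 < k.1 → p.2 < k.2 → p ∈ K :=
    fun hk h1 h2 => hconv.mem_of_lt_of_lt hx hk h1 h2
  obtain ⟨⟨u, y₀⟩, hu, hfst⟩ :=
    exists_forall_le_of_monotone hopen hcomp hne continuous_fst monotone_fst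
  obtain ⟨⟨x₀, v⟩, hv, hsnd⟩ :=
    exists_forall_le_of_monotone hopen hcomp hne continuous_snd monotone_snd
  simp only at hfst hsnd
  obtain ⟨b, hub, hb⟩ : ∃ b, (u, b) ∈ K ∧ ∀ t, (u, t) ∈ K → t ≤ b := by
    have hcl : IsClosed[ballTop (q2 N)] {p : ℝ × ℝ | u ≤ p.1} := by
      refine (@isOpen_compl_iff _ _ (ballTop (q2 N))).1 ((hopen _).2
        ⟨(isClosed_le continuous_const continuous_fst).isOpen_compl, ?_⟩)
      exact fun p r hrp hp hr => hp (le_trans (show u ≤ r.1 from hr) hrp.1)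
    obtain ⟨⟨u', b⟩, ⟨h, h'⟩, hmax⟩ := exists_forall_le_of_monotone hopen
      (@IsCompact.inter_right _ (ballTop (q2 N)) _ _ hcomp hcl) ⟨_, hu, le_refl u⟩
      continuous_snd monotone_snd
    obtain rfl : u' = u := le_antisymm (hfst _ h) h'
    exact ⟨b, h, fun t ht => hmax _ ⟨ht, le_refl u'⟩⟩
  obtain ⟨a, hav, ha⟩ : ∃ a, (a, v) ∈ K ∧ ∀ s, (s, v) ∈ K → s ≤ a := by
    have hcl : IsClosed[ballTop (q2 N)] {p : ℝ × ℝ | v ≤ p.2} := by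
      refine (@isOpen_compl_iff _ _ (ballTop (q2 N))).1 ((hopen _).2
        ⟨(isClosed_le continuous_const continuous_snd).isOpen_compl, ?_⟩)
      exact fun p r hrp hp hr => hp (le_trans (show v ≤ r.2 from hr) hrp.2)
    obtain ⟨⟨a, v'⟩, ⟨h, h'⟩, hmax⟩ := exists_forall_le_of_monotone hopen
      (@IsCompact.inter_right _ (ballTop (q2 N)) _ _ hcomp hcl) ⟨_, hv, le_refl v⟩
      continuous_fst monotone_fst
    obtain rfl : v' = v := le_antisymm (hsnd _ h) h'
    exact ⟨a, h, fun s hs => hmax _ ⟨hs, le_refl v'⟩⟩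
  by_cases huv : (u, v) ∈ K
  · refine Or.inl ⟨u, v, _, _, vform_of_convex hconv huv fun t ht => hsnd _ ht,
      wform_of_convex hconv huv fun s hs => hfst _ hs, Subset.antisymm (fun p hp => ?_) ?_⟩
    · rcases (hfst p hp).eq_or_lt with h1 | h1
      · exact Or.inl (Or.inl ⟨hp, h1⟩)
      rcases (hsnd p hp).eq_or_lt with h2 | h2
      · exact Or.inl (Or.inr ⟨hp, h2⟩)
      exact Or.inr ((mem_transl_thetaIntQ_iff hN0 hopen).2 ⟨h1, h2⟩)
    · rintro p ((hp | hp) | hp)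
      · exact hp.1
      · exact hp.1
      · obtain ⟨h1, h2⟩ := (mem_transl_thetaIntQ_iff hN0 hopen).1 hp
        exact hbelow huv h1 h2
  have hau : a < u := lt_of_le_of_ne (hfst _ hav) fun h => huv (h ▸ hav)
  have hbv : b < v := lt_of_le_of_ne (hsnd _ hub) fun h => huv (h ▸ hub)
  have hab : (a, b) ∈ K := by
    have h := hconv.add_smul_sub_mem hav hub (t := 1 / 2) (by norm_num)
    refine hbelow h ?_ ?_
    · simp; linarith
    · simp; linarith
  have hdown : ∀ p k : ℝ × ℝ, p ∈ Icc a u ×ˢ Icc b v → k ∈ K → p ≤ k → p ∈ K := by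
    rintro ⟨p1, p2⟩ ⟨k1, k2⟩ ⟨⟨h1, h2⟩, h3, h4⟩ hk ⟨h5, h6⟩
    simp only at h1 h2 h3 h4 h5 h6
    rcases h5.eq_or_lt with rfl | h5
    · rcases h6.eq_or_lt with rfl | h6
      · exact hk
      rcases h2.eq_or_lt with rfl | h2
      · exact absurd (hb _ hk) (not_le.2 (h3.trans_lt h6))
      obtain ⟨r, hr, hr1, hr2⟩ := hconv.exists_mem_fst_lt_and_lt_snd hk hub h6 h2
      exact hbelow hr hr1 hr2
    · rcases h6.eq_or_lt with rfl | h6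
      · rcases h4.eq_or_lt with rfl | h4
        · exact absurd (ha _ hk) (not_le.2 (h1.trans_lt h5))
        obtain ⟨r, hr, hr1, hr2⟩ := hconv.exists_mem_lt_fst_and_snd_lt hk hav h5 h4
        exact hbelow hr hr1 hr2
      · exact hbelow hk h5 h6
  have hconvR : Convex ℝ (Icc a u ×ˢ Icc b v) := (convex_Icc a u).prod (convex_Icc b v)
  have hcompR : IsCompact (Icc a u ×ˢ Icc b v) := isCompact_Icc.prod isCompact_Icc
  have hclosed : IsClosed (K ∩ Icc a u ×ˢ Icc b v) := by
    refine isClosed_of_closure_subset fun p hp => ?_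
    have hpR : p ∈ Icc a u ×ˢ Icc b v :=
      closure_minimal inter_subset_right hcompR.isClosed hp
    have hcont : Continuous fun r : ℝ × ℝ => min (r.1 - p.1) (r.2 - p.2) := by fun_prop
    obtain ⟨k, hk, hmax⟩ := exists_forall_le_of_monotone hopen hcomp hne hcont
      fun r s hrs => min_le_min (sub_le_sub_right hrs.1 _) (sub_le_sub_right hrs.2 _)
    have hle : p ∈ {r : ℝ × ℝ |
        min (r.1 - p.1) (r.2 - p.2) ≤ min (k.1 - p.1) (k.2 - p.2)} :=
      closure_minimal (fun r hr => hmax r hr.1)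
        (isClosed_le hcont continuous_const) hp
    simp only [mem_ofPred_eq, sub_self, min_self, le_min_iff, sub_nonneg] at hle
    exact ⟨hdown p k hpR hk hle, hpR⟩
  have hav₀ : (a, v) ∈ K ∩ Icc a u ×ˢ Icc b v := ⟨hav, ⟨le_rfl, hau.le⟩, hbv.le, le_rfl⟩
  have hub₀ : (u, b) ∈ K ∩ Icc a u ×ˢ Icc b v := ⟨hub, ⟨hau.le, le_rfl⟩, le_rfl, hbv.le⟩
  have hab₀ : (a, b) ∈ K ∩ Icc a u ×ˢ Icc b v := ⟨hab, ⟨le_rfl, hau.le⟩, le_rfl, hbv.le⟩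
  have hadd : ∀ {p k : ℝ × ℝ}, k ∈ K ∩ Icc a u ×ˢ Icc b v → p ≤ k →
      p ∈ K ∩ Icc a u ×ˢ Icc b v + theta0 N := fun {p k} hk hpk =>
    ⟨k, hk, p - k, (mem_theta0_iff hN0).2 (sub_nonpos.2 hpk), add_sub_cancel k p⟩
  refine Or.inr ⟨a, u, b, v, hau, hbv, K ∩ Icc a u ×ˢ Icc b v, hconv.inter hconvR,
    hcompR.of_isClosed_subset hclosed inter_subset_right, convexHull_min ?_ (hconv.inter hconvR),
    ?_, inter_subset_left, fun p hp => ?_, _, _, vform_of_convex hconv hub hb,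
    wform_of_convex hconv hav ha, Subset.antisymm (fun p hp => ?_) ?_⟩
  · rintro p (rfl | rfl | rfl) <;> assumption
  · refine inter_subset_right.trans ?_
    rw [← segment_eq_Icc hau.le, ← segment_eq_Icc hbv.le, ← convexHull_pair, ← convexHull_pair,
      ← convexHull_prod]
    refine convexHull_mono ?_
    rintro ⟨p1, p2⟩ ⟨rfl | rfl, rfl | rfl⟩ <;> simp
  · rcases lt_or_ge p.1 a with h1 | h1
    · exact hadd hav₀ ⟨h1.le, hsnd p hp⟩
    rcases lt_or_ge p.2 b with h2 | h2
    · exact hadd hub₀ ⟨hfst p hp, h2.le⟩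
    exact hadd ⟨hp, ⟨h1, hfst p hp⟩, h2, hsnd p hp⟩ le_rfl
  · rcases lt_or_ge p.1 a with h1 | h1
    · rcases (hsnd p hp).eq_or_lt with h | h
      · exact Or.inr ⟨hp, h⟩
      · exact Or.inl (Or.inl (Or.inl (Or.inr ((mem_transl_thetaIntQ_iff hN0 hopen).2 ⟨h1, h⟩))))
    rcases lt_or_ge p.2 b with h2 | h2
    · rcases (hfst p hp).eq_or_lt with h | h
      · exact Or.inl (Or.inr ⟨hp, h⟩)
      · exact Or.inl (Or.inl (Or.inr ((mem_transl_thetaIntQ_iff hN0 hopen).2 ⟨h, h2⟩)))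
    exact Or.inl (Or.inl (Or.inl (Or.inl ⟨hp, ⟨h1, hfst p hp⟩, h2, hsnd p hp⟩)))
  · rintro p ((((hp | hp) | hp) | hp) | hp)
    · exact hp.1
    · obtain ⟨h1, h2⟩ := (mem_transl_thetaIntQ_iff hN0 hopen).1 hp
      exact hbelow hav h1 h2
    · obtain ⟨h1, h2⟩ := (mem_transl_thetaIntQ_iff hN0 hopen).1 hp
      exact hbelow hub h1 h2
    · exact hp.1
    · exact hp.1
end
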